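/- arXiv:2602.06284 — 2 statements merged into one kernel-verified Lean document; each statement's English description precedes it below -/
import Mathlib

section
/- Let H be a real Hilbert space, n ≥ 1, L : H → ℝⁿ a continuous linear map, and Y ∈ ℝⁿ with {u : L u = Y} nonempty. For α > 0 let u^α be the unique minimizer over H of E_α(u) = (1/2)‖u‖² + (1/(2α))‖L u − Y‖², and let u⁰ be the unique minimizer of (1/2)‖u‖² subject to L u = Y. Then u^α converges to u⁰ in the norm of H as α → 0⁺. -/
open scoped RealInnerProductSpace

/-- Convergence of the regression minimizers to the exact interpolation minimizer:
`u^α → u⁰` in `H` as `α → 0⁺`. -/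
theorem regression_tendsto_interpolation
    {H : Type*} [NormedAddCommGroup H] [InnerProductSpace ℝ H] [CompleteSpace H]
    {n : ℕ} (hn : 1 ≤ n) (L : H →L[ℝ] EuclideanSpace ℝ (Fin n))
    (Y : EuclideanSpace ℝ (Fin n)) (hY : ∃ u : H, L u = Y)
    (u : ℝ → H)
    (hu : ∀ α : ℝ, 0 < α → ∀ v : H,
      (1 / 2) * ‖u α‖ ^ 2 + (1 / (2 * α)) * ‖L (u α) - Y‖ ^ 2 ≤
        (1 / 2) * ‖v‖ ^ 2 + (1 / (2 * α)) * ‖L v - Y‖ ^ 2)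
    (u0 : H) (hu0 : L u0 = Y)
    (hmin : ∀ v : H, L v = Y → (1 / 2) * ‖u0‖ ^ 2 ≤ (1 / 2) * ‖v‖ ^ 2) :
    Filter.Tendsto u (nhdsWithin 0 (Set.Ioi 0)) (nhds u0) := by
  have horth : ∀ v : H, L v = 0 → ⟪u0, v⟫ = 0 := by
    intro v hv
    have hq : 0 < ‖v‖ ^ 2 + 1 := by positivity
    have h := hmin (u0 + (-⟪u0, v⟫ / (‖v‖ ^ 2 + 1)) • v) (by simp [hv, hu0])
    rw [norm_add_sq_real, inner_smul_right, norm_smul, mul_pow, Real.norm_eq_abs, sq_abs] at h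
    generalize ⟪u0, v⟫ = c at *
    generalize ‖v‖ ^ 2 = q at *
    obtain ⟨t, ht⟩ : ∃ t, t = -c / (q + 1) := ⟨_, rfl⟩
    rw [← ht] at h
    have hc : c = -(t * (q + 1)) := by
      rw [ht]; field_simp
    rw [hc] at h ⊢
    have : t = 0 := by
      have h2 : t ^ 2 * (q + 2) ≤ 0 := by nlinarith
      have h3 : t ^ 2 ≤ 0 := by
        by_contra hcon
        push Not at hcon
        have := mul_pos hcon (show 0 < q + 2 by linarith)
        linarith
      exact pow_eq_zero_iff (two_ne_zero) |>.1 (le_antisymm h3 (sq_nonneg t))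
    simp [this]
  obtain ⟨w, hw⟩ : ∃ w, ContinuousLinearMap.adjoint L w = u0 := by
    have h1 : u0 ∈ (L.ker)ᗮ := by
      rw [Submodule.mem_orthogonal']
      intro v hv
      exact horth v (by simpa using hv)
    rw [ContinuousLinearMap.orthogonal_ker] at h1
    rw [IsClosed.submodule_topologicalClosure_eq
      (Submodule.closed_of_finiteDimensional _)] at h1
    simpa using h1
  have hbound : ∀ α : ℝ, 0 < α → ‖u α - u0‖ ^ 2 ≤ α * ‖w‖ ^ 2 := by
    intro α hα
    have h := hu α hα u0
    rw [hu0] at h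
    have e1 : ‖u α - u0‖ ^ 2 = ‖u α‖ ^ 2 - ‖u0‖ ^ 2 - 2 * ⟪w, L (u α) - Y⟫ := by
      have h3 : ⟪w, L (u α) - Y⟫ = ⟪u α, u0⟫ - ‖u0‖ ^ 2 := by
        rw [← hu0, ← map_sub, ← ContinuousLinearMap.adjoint_inner_left, hw, inner_sub_right,
          real_inner_self_eq_norm_sq, real_inner_comm]
      rw [norm_sub_sq_real, h3]; ring
    have e2 : 0 ≤ ‖(L (u α) - Y) + α • w‖ ^ 2 := by positivity
    rw [norm_add_sq_real, inner_smul_right, norm_smul, mul_pow, Real.norm_eq_abs, sq_abs,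
      real_inner_comm] at e2
    simp only [sub_self, norm_zero] at h
    generalize ‖L (u α) - Y‖ = r at *
    generalize ⟪w, L (u α) - Y⟫ = c at *
    have e3 : 0 ≤ (r ^ 2 + 2 * (α * c) + α ^ 2 * ‖w‖ ^ 2) / α := div_nonneg e2 hα.le
    have e4 : (r ^ 2 + 2 * (α * c) + α ^ 2 * ‖w‖ ^ 2) / α
        = 2 * ((1 / (2 * α)) * r ^ 2) + 2 * c + α * ‖w‖ ^ 2 := by
      field_simp
    rw [e4] at e3
    rw [e1]
    linarith
  rw [tendsto_iff_norm_sub_tendsto_zero]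
  have hlim : Filter.Tendsto (fun α : ℝ => √(α * ‖w‖ ^ 2)) (nhdsWithin 0 (Set.Ioi 0))
      (nhds 0) := by
    have hc : Continuous (fun α : ℝ => √(α * ‖w‖ ^ 2)) := by fun_prop
    have := hc.tendsto 0
    simp only [zero_mul, Real.sqrt_zero] at this
    exact this.mono_left nhdsWithin_le_nhds
  refine squeeze_zero' (Filter.Eventually.of_forall fun _ => norm_nonneg _) ?_ hlim
  filter_upwards [self_mem_nhdsWithin] with α hα
  exact Real.le_sqrt_of_sq_le (hbound α hα)
end

section
/- Let H be a real Hilbert space, n ≥ 1, L : H → ℝⁿ a continuous linear map, and Y ∈ ℝⁿ with {u : L u = Y} nonempty. For α > 0 let u^α be the unique minimizer over H of E_α(u) = (1/2)‖u‖² + (1/(2α))‖L u − Y‖², and let u⁰ be the unique minimizer of (1/2)‖u‖² subject to L u = Y. Then for all 0 < α₀ < α₁ one has ‖u^{α₁}‖ ≤ ‖u^{α₀}‖ ≤ ‖u⁰‖. -/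
open scoped RealInnerProductSpace

/-- Monotonicity of the norms of the regression minimizers: for `0 < α₀ < α₁`,
`‖u^{α₁}‖ ≤ ‖u^{α₀}‖ ≤ ‖u⁰‖`. -/
theorem regression_norms_monotone
    {H : Type*} [NormedAddCommGroup H] [InnerProductSpace ℝ H] [CompleteSpace H]
    {n : ℕ} (hn : 1 ≤ n) (L : H →L[ℝ] EuclideanSpace ℝ (Fin n))
    (Y : EuclideanSpace ℝ (Fin n)) (hY : ∃ u : H, L u = Y)
    (u : ℝ → H)
    (hu : ∀ α : ℝ, 0 < α → ∀ v : H,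
      (1 / 2) * ‖u α‖ ^ 2 + (1 / (2 * α)) * ‖L (u α) - Y‖ ^ 2 ≤
        (1 / 2) * ‖v‖ ^ 2 + (1 / (2 * α)) * ‖L v - Y‖ ^ 2)
    (u0 : H) (hu0 : L u0 = Y)
    (hmin : ∀ v : H, L v = Y → (1 / 2) * ‖u0‖ ^ 2 ≤ (1 / 2) * ‖v‖ ^ 2)
    (α₀ α₁ : ℝ) (h₀ : 0 < α₀) (h₀₁ : α₀ < α₁) :
    ‖u α₁‖ ≤ ‖u α₀‖ ∧ ‖u α₀‖ ≤ ‖u0‖ := by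
  have h₁ : 0 < α₁ := h₀.trans h₀₁
  -- the minimality inequality multiplied by `2 * α`
  have key : ∀ α : ℝ, 0 < α → ∀ v : H,
      α * ‖u α‖ ^ 2 + ‖L (u α) - Y‖ ^ 2 ≤ α * ‖v‖ ^ 2 + ‖L v - Y‖ ^ 2 := by
    intro α hα v
    have h := mul_le_mul_of_nonneg_left (hu α hα v) (by positivity : (0 : ℝ) ≤ 2 * α)
    have e : ∀ a b : ℝ, 2 * α * ((1 / 2) * a + (1 / (2 * α)) * b) = α * a + b := by
      intro a b
      field_simp
    rwa [e, e] at h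
  constructor
  · have A := key α₀ h₀ (u α₁)
    have B := key α₁ h₁ (u α₀)
    have C : (α₁ - α₀) * ‖u α₁‖ ^ 2 ≤ (α₁ - α₀) * ‖u α₀‖ ^ 2 := by linarith
    exact (fun h k => (pow_le_pow_iff_left₀ (norm_nonneg _) k two_ne_zero).1 h) (le_of_mul_le_mul_left C (sub_pos.2 h₀₁)) (norm_nonneg _)
  · have A := key α₀ h₀ u0
    have hz : ‖L u0 - Y‖ ^ 2 = 0 := by simp [hu0]
    have C : α₀ * ‖u α₀‖ ^ 2 ≤ α₀ * ‖u0‖ ^ 2 := by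
      have := sq_nonneg ‖L (u α₀) - Y‖
      linarith
    exact (fun h k => (pow_le_pow_iff_left₀ (norm_nonneg _) k two_ne_zero).1 h) (le_of_mul_le_mul_left C h₀) (norm_nonneg _)
end
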